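/- arXiv:2001.05117 — 2 statements merged into one kernel-verified Lean document; each statement's English description precedes it below -/
import Mathlib

section
/- (Lemma 1, threshold equality) Fix a target erasure probability δ ∈ [0,1]. The set of channel erasure probabilities A_MD = {ε ∈ [0,1] : for every (i,j) with 0 ≤ i < L_1 and j ∈ ℤ/L_2ℤ, limsup_{l→∞} x^{(l)}_{(i,j)}(ε) ≤ δ} equals the set A_1D = {ε ∈ [0,1] : for every i with 0 ≤ i < L_1, limsup_{l→∞} x̄^{(l)}_i(ε) ≤ δ}; consequently the BP thresholds coincide: sSup A_MD = sSup A_1D. -/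
/-- Check-node DE map `Y(z)` for the MD-SC ensemble. -/
noncomputable def chkY (L₂ dr γ₁ γ₂ : ℕ) (T : ℝ) (z : ℤ × ZMod L₂ → ℝ)
    (p : ℤ × ZMod L₂) : ℝ :=
  1 - (1 - ((1 - T) / (γ₁ : ℝ)) * ∑ k ∈ Finset.range γ₁, z (p.1 - (k : ℤ), p.2)
        - (T / ((γ₁ : ℝ) * ((γ₂ : ℝ) - 1))) *
            ∑ k ∈ Finset.range γ₁, ∑ r ∈ Finset.Icc 1 (γ₂ - 1),
              z (p.1 - (k : ℤ), p.2 - (r : ZMod L₂))) ^ (dr - 1)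

/-- One-step DE update `F(z)` for the MD-SC ensemble. -/
noncomputable def updF (L₂ dl dr γ₁ γ₂ : ℕ) (T ε : ℝ) (z : ℤ × ZMod L₂ → ℝ)
    (p : ℤ × ZMod L₂) : ℝ :=
  ε * (((1 - T) / (γ₁ : ℝ)) *
          ∑ k ∈ Finset.range γ₁, chkY L₂ dr γ₁ γ₂ T z (p.1 + (k : ℤ), p.2)
        + (T / ((γ₁ : ℝ) * ((γ₂ : ℝ) - 1))) *
            ∑ k ∈ Finset.range γ₁, ∑ r ∈ Finset.Icc 1 (γ₂ - 1),
              chkY L₂ dr γ₁ γ₂ T z (p.1 + (k : ℤ), p.2 + (r : ZMod L₂))) ^ (dl - 1)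
/-- The MD density-evolution sequence `x^[l]`. -/
noncomputable def xMD (L₁ L₂ dl dr γ₁ γ₂ : ℕ) (T ε : ℝ) : ℕ → ℤ × ZMod L₂ → ℝ
  | 0 => fun p => if 0 ≤ p.1 ∧ p.1 < (L₁ : ℤ) then 1 else 0
  | l + 1 => fun p =>
      if 0 ≤ p.1 ∧ p.1 < (L₁ : ℤ) then
        updF L₂ dl dr γ₁ γ₂ T ε (xMD L₁ L₂ dl dr γ₁ γ₂ T ε l) p
      else 0
/-- Check-node DE map for the 1D SC ensemble. -/
noncomputable def chkY1 (dr γ₁ : ℕ) (z : ℤ → ℝ) (i : ℤ) : ℝ :=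
  1 - (1 - (1 / (γ₁ : ℝ)) * ∑ k ∈ Finset.range γ₁, z (i - (k : ℤ))) ^ (dr - 1)

/-- The 1D density-evolution sequence `x̄^[l]`. -/
noncomputable def x1D (L₁ dl dr γ₁ : ℕ) (ε : ℝ) : ℕ → ℤ → ℝ
  | 0 => fun i => if 0 ≤ i ∧ i < (L₁ : ℤ) then 1 else 0
  | l + 1 => fun i =>
      if 0 ≤ i ∧ i < (L₁ : ℤ) then
        ε * ((1 / (γ₁ : ℝ)) *
            ∑ k ∈ Finset.range γ₁, chkY1 dr γ₁ (x1D L₁ dl dr γ₁ ε l) (i + (k : ℤ))) ^ (dl - 1)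
      else 0

/-- Coupling weights applied to a summand that does not depend on the replica index
reduce to the uniform average. -/
theorem coupling_weights_const {γ₁ γ₂ : ℕ} (hγ₁ : 1 ≤ γ₁) (hγ₂ : 2 ≤ γ₂) (T : ℝ) (f : ℕ → ℝ) :
    ((1 - T) / (γ₁ : ℝ)) * ∑ k ∈ Finset.range γ₁, f k
        + (T / ((γ₁ : ℝ) * ((γ₂ : ℝ) - 1))) *
            ∑ k ∈ Finset.range γ₁, ∑ _r ∈ Finset.Icc 1 (γ₂ - 1), f k
      = (1 / (γ₁ : ℝ)) * ∑ k ∈ Finset.range γ₁, f k := by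
  have h₁ : (γ₁ : ℝ) ≠ 0 := by positivity
  have h₂ : (γ₂ : ℝ) - 1 ≠ 0 := by
    have : (2 : ℝ) ≤ γ₂ := by exact_mod_cast hγ₂
    linarith
  have hcast : ((γ₂ - 1 : ℕ) : ℝ) = (γ₂ : ℝ) - 1 := by
    rw [Nat.cast_sub (by omega), Nat.cast_one]
  simp only [Finset.sum_const, Nat.card_Icc, Nat.add_sub_cancel, nsmul_eq_mul,
    ← Finset.mul_sum, hcast]
  field_simp
  ring

/-- On profiles that do not depend on the replica index, the MD check-node map is the 1D one. -/
theorem chkY_fst {L₂ dr γ₁ γ₂ : ℕ} (hγ₁ : 1 ≤ γ₁) (hγ₂ : 2 ≤ γ₂) (T : ℝ) (z : ℤ → ℝ)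
    (p : ℤ × ZMod L₂) :
    chkY L₂ dr γ₁ γ₂ T (fun q => z q.1) p = chkY1 dr γ₁ z p.1 := by
  simp only [chkY, chkY1]
  rw [sub_sub, coupling_weights_const hγ₁ hγ₂ T (fun k => z (p.1 - (k : ℤ)))]

/-- The MD density evolution is constant in the replica index and equals the 1D one. -/
theorem xMD_eq_x1D {L₁ L₂ dl dr γ₁ γ₂ : ℕ} (hγ₁ : 1 ≤ γ₁) (hγ₂ : 2 ≤ γ₂) (T ε : ℝ) (l : ℕ) :
    xMD L₁ L₂ dl dr γ₁ γ₂ T ε l = fun p => x1D L₁ dl dr γ₁ ε l p.1 := by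
  induction l with
  | zero => rfl
  | succ l ih =>
    funext p
    simp only [xMD, x1D, updF, ih, chkY_fst hγ₁ hγ₂]
    rw [coupling_weights_const hγ₁ hγ₂ T
      (fun k => chkY1 dr γ₁ (x1D L₁ dl dr γ₁ ε l) (p.1 + (k : ℤ)))]

/-- Lemma 1, threshold equality: for a fixed target erasure
probability `δ ∈ [0,1]`, the set of channel parameters `ε ∈ [0,1]` for which the
MD DE drives every section `(i,j)` with `0 ≤ i < L₁` down to `limsup ≤ δ` equals
the corresponding set for the 1D DE, and consequently the BP thresholds
(suprema of these sets) coincide. -/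
theorem stmt2 (dl dr L₁ L₂ γ₁ γ₂ : ℕ) (T δ : ℝ)
    (hdl : 2 ≤ dl) (hdr : 2 ≤ dr) (hL₁ : 1 ≤ L₁) (hL₂ : 2 ≤ L₂)
    (hγ₁ : 1 ≤ γ₁) (hγ₁L : γ₁ ≤ L₁) (hγ₂ : 2 ≤ γ₂) (hγ₂L : γ₂ ≤ L₂)
    (hT : T ∈ Set.Icc (0 : ℝ) 1) (hδ : δ ∈ Set.Icc (0 : ℝ) 1) :
    ({ε : ℝ | ε ∈ Set.Icc (0 : ℝ) 1 ∧ ∀ (i : ℤ) (j : ZMod L₂), 0 ≤ i → i < (L₁ : ℤ) →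
        Filter.limsup (fun l => xMD L₁ L₂ dl dr γ₁ γ₂ T ε l (i, j)) Filter.atTop ≤ δ}
      = {ε : ℝ | ε ∈ Set.Icc (0 : ℝ) 1 ∧ ∀ i : ℤ, 0 ≤ i → i < (L₁ : ℤ) →
        Filter.limsup (fun l => x1D L₁ dl dr γ₁ ε l i) Filter.atTop ≤ δ}) ∧
    sSup {ε : ℝ | ε ∈ Set.Icc (0 : ℝ) 1 ∧ ∀ (i : ℤ) (j : ZMod L₂), 0 ≤ i → i < (L₁ : ℤ) →
        Filter.limsup (fun l => xMD L₁ L₂ dl dr γ₁ γ₂ T ε l (i, j)) Filter.atTop ≤ δ}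
      = sSup {ε : ℝ | ε ∈ Set.Icc (0 : ℝ) 1 ∧ ∀ i : ℤ, 0 ≤ i → i < (L₁ : ℤ) →
        Filter.limsup (fun l => x1D L₁ dl dr γ₁ ε l i) Filter.atTop ≤ δ} := by
  refine (fun h => ⟨h, congrArg sSup h⟩) ?_
  ext ε
  simp only [Set.mem_ofPred_eq, xMD_eq_x1D hγ₁ hγ₂]
  exact and_congr_right fun _ => ⟨fun h i => h i 0, fun h i _ => h i⟩
end

section
/- (Key induction in the proof of Lemma 3) Let W, W' ∈ ℕ^{L_2} be window-size vectors with W'_j ≤ W_j for every j ∈ {0,…,L_2−1}, so that S^{W'}_{(0,0)} ⊆ S^{W}_{(0,0)}. Let q^{(l)}_W and q^{(l)}_{W'} denote the worst-case window constellations obtained from the common initial constellation q^{(0)}_{(i,j)} = δ for i < 0 and q^{(0)}_{(i,j)} = 1 for i ≥ 0 by iterating the windowed update with windows S^{W}_{(0,0)} and S^{W'}_{(0,0)} respectively, where δ ∈ [0,1]. Then for every l ≥ 0 and every section (i,j), q^{(l)}_{W,(i,j)} ≤ q^{(l)}_{W',(i,j)}. -/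
open Classical in
/-- The windowed DE update with window `S`. -/
noncomputable def winUpd (L₂ dl dr γ₁ γ₂ : ℕ) (T ε : ℝ) (S : Set (ℤ × ZMod L₂))
    (z : ℤ × ZMod L₂ → ℝ) (p : ℤ × ZMod L₂) : ℝ :=
  if p ∈ S then updF L₂ dl dr γ₁ γ₂ T ε z p else z p

/-- Iterates of the windowed DE update starting from `z₀`. -/
noncomputable def winIter (L₂ dl dr γ₁ γ₂ : ℕ) (T ε : ℝ) (S : Set (ℤ × ZMod L₂))
    (z₀ : ℤ × ZMod L₂ → ℝ) : ℕ → ℤ × ZMod L₂ → ℝ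
  | 0 => z₀
  | l + 1 => winUpd L₂ dl dr γ₁ γ₂ T ε S (winIter L₂ dl dr γ₁ γ₂ T ε S z₀ l)
/-- The window configuration `S^W_{(i_t,j_t)}` for window-size vector `W` and target
section `(i_t, j_t)`. -/
def winConfig (L₂ : ℕ) (W : ZMod L₂ → ℕ) (t : ℤ × ZMod L₂) : Set (ℤ × ZMod L₂) :=
  {p | ∃ r : ℕ, r < L₂ ∧ ∃ k : ℕ, k < W (t.2 + (r : ZMod L₂)) ∧
        p = (t.1 + (k : ℤ), t.2 + (r : ZMod L₂))}

/-- The worst-case initial constellation: `δ` for `i < 0` and `1` for `i ≥ 0`. -/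
noncomputable def worstInit (L₂ : ℕ) (δ : ℝ) : ℤ × ZMod L₂ → ℝ :=
  fun p => if p.1 < 0 then δ else 1

/-- The worst-case window constellation `q^[l]` for window-size vector `W`. -/
noncomputable def worstQ (L₂ dl dr γ₁ γ₂ : ℕ) (T ε δ : ℝ) (W : ZMod L₂ → ℕ) :
    ℕ → ℤ × ZMod L₂ → ℝ :=
  winIter L₂ dl dr γ₁ γ₂ T ε (winConfig L₂ W ((0 : ℤ), (0 : ZMod L₂))) (worstInit L₂ δ)

/-- The weighted average with total weight `1 - T` on `f` and `T` on `g` that occurs in both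
halves of a DE update. -/
noncomputable def mixAvg (γ₁ γ₂ : ℕ) (T : ℝ) (f : ℕ → ℝ) (g : ℕ → ℕ → ℝ) : ℝ :=
  ((1 - T) / (γ₁ : ℝ)) * ∑ k ∈ Finset.range γ₁, f k
    + (T / ((γ₁ : ℝ) * ((γ₂ : ℝ) - 1))) *
        ∑ k ∈ Finset.range γ₁, ∑ r ∈ Finset.Icc 1 (γ₂ - 1), g k r

section
variable {γ₁ γ₂ : ℕ} {T : ℝ}

theorem mixAvg_mono (hγ₂ : 2 ≤ γ₂) (hT : T ∈ Set.Icc (0 : ℝ) 1)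
    {f f' : ℕ → ℝ} {g g' : ℕ → ℕ → ℝ} (hf : ∀ k, f k ≤ f' k) (hg : ∀ k r, g k r ≤ g' k r) :
    mixAvg γ₁ γ₂ T f g ≤ mixAvg γ₁ γ₂ T f' g' := by
  have h2 : (2 : ℝ) ≤ γ₂ := by exact_mod_cast hγ₂
  have ha : 0 ≤ (1 - T) / (γ₁ : ℝ) := div_nonneg (sub_nonneg.2 hT.2) (Nat.cast_nonneg _)
  have hb : 0 ≤ T / ((γ₁ : ℝ) * ((γ₂ : ℝ) - 1)) :=
    div_nonneg hT.1 (mul_nonneg (Nat.cast_nonneg _) (by linarith))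
  exact add_le_add
    (mul_le_mul_of_nonneg_left (Finset.sum_le_sum fun k _ => hf k) ha)
    (mul_le_mul_of_nonneg_left
      (Finset.sum_le_sum fun k _ => Finset.sum_le_sum fun r _ => hg k r) hb)

theorem mixAvg_const (hγ₁ : 1 ≤ γ₁) (hγ₂ : 2 ≤ γ₂) (c : ℝ) :
    mixAvg γ₁ γ₂ T (fun _ => c) (fun _ _ => c) = c := by
  have h1 : (γ₁ : ℝ) ≠ 0 := by positivity
  have h2 : (2 : ℝ) ≤ γ₂ := by exact_mod_cast hγ₂
  have h3 : (γ₂ : ℝ) - 1 ≠ 0 := by linarith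
  simp only [mixAvg, Finset.sum_const, Finset.card_range, Nat.card_Icc, nsmul_eq_mul,
    Nat.add_sub_cancel]
  rw [Nat.cast_sub (by lia : 1 ≤ γ₂), Nat.cast_one]
  field_simp
  ring

theorem mixAvg_mem_Icc (hγ₁ : 1 ≤ γ₁) (hγ₂ : 2 ≤ γ₂) (hT : T ∈ Set.Icc (0 : ℝ) 1)
    {f : ℕ → ℝ} {g : ℕ → ℕ → ℝ} (hf : ∀ k, f k ∈ Set.Icc (0 : ℝ) 1)
    (hg : ∀ k r, g k r ∈ Set.Icc (0 : ℝ) 1) :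
    mixAvg γ₁ γ₂ T f g ∈ Set.Icc (0 : ℝ) 1 := by
  constructor
  · rw [← mixAvg_const (T := T) hγ₁ hγ₂ 0]
    exact mixAvg_mono hγ₂ hT (fun k => (hf k).1) (fun k r => (hg k r).1)
  · rw [← mixAvg_const (T := T) hγ₁ hγ₂ 1]
    exact mixAvg_mono hγ₂ hT (fun k => (hf k).2) (fun k r => (hg k r).2)

variable {L₂ dl dr : ℕ} {ε : ℝ} {z z' : ℤ × ZMod L₂ → ℝ}

theorem chkY_eq (p : ℤ × ZMod L₂) :
    chkY L₂ dr γ₁ γ₂ T z p = 1 - (1 - mixAvg γ₁ γ₂ T (fun k => z (p.1 - (k : ℤ), p.2))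
      (fun k r => z (p.1 - (k : ℤ), p.2 - (r : ZMod L₂)))) ^ (dr - 1) := by
  rw [chkY, mixAvg, sub_sub]

theorem updF_eq (p : ℤ × ZMod L₂) :
    updF L₂ dl dr γ₁ γ₂ T ε z p =
      ε * mixAvg γ₁ γ₂ T (fun k => chkY L₂ dr γ₁ γ₂ T z (p.1 + (k : ℤ), p.2))
        (fun k r => chkY L₂ dr γ₁ γ₂ T z (p.1 + (k : ℤ), p.2 + (r : ZMod L₂))) ^ (dl - 1) :=
  rfl

theorem chkY_mem_Icc (hγ₁ : 1 ≤ γ₁) (hγ₂ : 2 ≤ γ₂) (hT : T ∈ Set.Icc (0 : ℝ) 1)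
    (hz : ∀ p, z p ∈ Set.Icc (0 : ℝ) 1) (p : ℤ × ZMod L₂) :
    chkY L₂ dr γ₁ γ₂ T z p ∈ Set.Icc (0 : ℝ) 1 := by
  rw [chkY_eq, ← Set.Icc.mem_iff_one_sub_mem]
  obtain ⟨h0, h1⟩ := Set.Icc.mem_iff_one_sub_mem.1 (mixAvg_mem_Icc hγ₁ hγ₂ hT
    (fun k => hz (p.1 - (k : ℤ), p.2)) (fun k r => hz (p.1 - (k : ℤ), p.2 - (r : ZMod L₂))))
  exact ⟨pow_nonneg h0 _, pow_le_one₀ h0 h1⟩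

theorem chkY_mono (hγ₁ : 1 ≤ γ₁) (hγ₂ : 2 ≤ γ₂) (hT : T ∈ Set.Icc (0 : ℝ) 1)
    (hz' : ∀ p, z' p ∈ Set.Icc (0 : ℝ) 1) (hzz' : ∀ p, z p ≤ z' p) (p : ℤ × ZMod L₂) :
    chkY L₂ dr γ₁ γ₂ T z p ≤ chkY L₂ dr γ₁ γ₂ T z' p := by
  rw [chkY_eq, chkY_eq]
  have h1 := (mixAvg_mem_Icc hγ₁ hγ₂ hT (fun k => hz' (p.1 - (k : ℤ), p.2))
    (fun k r => hz' (p.1 - (k : ℤ), p.2 - (r : ZMod L₂)))).2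
  exact sub_le_sub_left (pow_le_pow_left₀ (sub_nonneg.2 h1)
    (sub_le_sub_left (mixAvg_mono hγ₂ hT (fun _ => hzz' _) (fun _ _ => hzz' _)) _) _) _

theorem updF_mem_Icc (hγ₁ : 1 ≤ γ₁) (hγ₂ : 2 ≤ γ₂) (hT : T ∈ Set.Icc (0 : ℝ) 1)
    (hε : ε ∈ Set.Icc (0 : ℝ) 1) (hz : ∀ p, z p ∈ Set.Icc (0 : ℝ) 1) (p : ℤ × ZMod L₂) :
    updF L₂ dl dr γ₁ γ₂ T ε z p ∈ Set.Icc (0 : ℝ) 1 := by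
  rw [updF_eq]
  have hY := chkY_mem_Icc (dr := dr) hγ₁ hγ₂ hT hz
  obtain ⟨h0, h1⟩ := mixAvg_mem_Icc hγ₁ hγ₂ hT (fun k => hY (p.1 + (k : ℤ), p.2))
    (fun k r => hY (p.1 + (k : ℤ), p.2 + (r : ZMod L₂)))
  exact ⟨mul_nonneg hε.1 (pow_nonneg h0 _),
    mul_le_one₀ hε.2 (pow_nonneg h0 _) (pow_le_one₀ h0 h1)⟩

theorem updF_mono (hγ₁ : 1 ≤ γ₁) (hγ₂ : 2 ≤ γ₂) (hT : T ∈ Set.Icc (0 : ℝ) 1) (hε : 0 ≤ ε)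
    (hz : ∀ p, z p ∈ Set.Icc (0 : ℝ) 1) (hz' : ∀ p, z' p ∈ Set.Icc (0 : ℝ) 1)
    (hzz' : ∀ p, z p ≤ z' p) (p : ℤ × ZMod L₂) :
    updF L₂ dl dr γ₁ γ₂ T ε z p ≤ updF L₂ dl dr γ₁ γ₂ T ε z' p := by
  rw [updF_eq, updF_eq]
  have hY := chkY_mem_Icc (dr := dr) hγ₁ hγ₂ hT hz
  have hYY := chkY_mono (dr := dr) hγ₁ hγ₂ hT hz' hzz'
  have h0 := (mixAvg_mem_Icc hγ₁ hγ₂ hT (fun k => hY (p.1 + (k : ℤ), p.2))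
    (fun k r => hY (p.1 + (k : ℤ), p.2 + (r : ZMod L₂)))).1
  exact mul_le_mul_of_nonneg_left (pow_le_pow_left₀ h0
    (mixAvg_mono hγ₂ hT (fun _ => hYY _) (fun _ _ => hYY _)) _) hε

variable {S S' : Set (ℤ × ZMod L₂)}

theorem winIter_mem_Icc (hγ₁ : 1 ≤ γ₁) (hγ₂ : 2 ≤ γ₂) (hT : T ∈ Set.Icc (0 : ℝ) 1)
    (hε : ε ∈ Set.Icc (0 : ℝ) 1) (hz : ∀ p, z p ∈ Set.Icc (0 : ℝ) 1) (l : ℕ)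
    (p : ℤ × ZMod L₂) :
    winIter L₂ dl dr γ₁ γ₂ T ε S z l p ∈ Set.Icc (0 : ℝ) 1 := by
  induction l generalizing p with
  | zero => exact hz p
  | succ l ih =>
    rw [winIter, winUpd]
    split_ifs
    · exact updF_mem_Icc hγ₁ hγ₂ hT hε ih p
    · exact ih p

theorem winIter_of_notMem {p : ℤ × ZMod L₂} (hp : p ∉ S) (l : ℕ) :
    winIter L₂ dl dr γ₁ γ₂ T ε S z l p = z p := by
  induction l with
  | zero => rfl
  | succ l ih => rw [winIter, winUpd, if_neg hp, ih]

/-- Enlarging the window by sections whose initial value is `1` decreases the iterates. -/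
theorem winIter_anti (hγ₁ : 1 ≤ γ₁) (hγ₂ : 2 ≤ γ₂) (hT : T ∈ Set.Icc (0 : ℝ) 1)
    (hε : ε ∈ Set.Icc (0 : ℝ) 1) (hz : ∀ p, z p ∈ Set.Icc (0 : ℝ) 1) (hS : S' ⊆ S)
    (hone : ∀ p ∈ S, z p = 1) (l : ℕ) (p : ℤ × ZMod L₂) :
    winIter L₂ dl dr γ₁ γ₂ T ε S z l p ≤ winIter L₂ dl dr γ₁ γ₂ T ε S' z l p := by
  induction l generalizing p with
  | zero => exact le_rfl
  | succ l ih =>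
    by_cases hp' : p ∈ S'
    · rw [winIter, winIter, winUpd, winUpd, if_pos hp', if_pos (hS hp')]
      exact updF_mono hγ₁ hγ₂ hT hε.1 (winIter_mem_Icc hγ₁ hγ₂ hT hε hz l)
        (winIter_mem_Icc hγ₁ hγ₂ hT hε hz l) ih p
    · rw [winIter_of_notMem hp']
      by_cases hp : p ∈ S
      · rw [hone p hp]
        exact (winIter_mem_Icc hγ₁ hγ₂ hT hε hz _ p).2
      · rw [winIter_of_notMem hp]

theorem winConfig_mono {W W' : ZMod L₂ → ℕ} (hWW' : ∀ j, W' j ≤ W j) (t : ℤ × ZMod L₂) :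
    winConfig L₂ W' t ⊆ winConfig L₂ W t := by
  rintro p ⟨r, hr, k, hk, rfl⟩
  exact ⟨r, hr, k, hk.trans_le (hWW' _), rfl⟩

theorem worstInit_mem_Icc {δ : ℝ} (hδ : δ ∈ Set.Icc (0 : ℝ) 1) (p : ℤ × ZMod L₂) :
    worstInit L₂ δ p ∈ Set.Icc (0 : ℝ) 1 := by
  rw [worstInit]
  split_ifs
  · exact hδ
  · exact ⟨zero_le_one, le_rfl⟩

theorem worstInit_of_mem_winConfig {δ : ℝ} {W : ZMod L₂ → ℕ} {p : ℤ × ZMod L₂}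
    (hp : p ∈ winConfig L₂ W (0, 0)) : worstInit L₂ δ p = 1 := by
  obtain ⟨r, -, k, -, rfl⟩ := hp
  exact if_neg (by simp)

end

/-- key induction in the proof of Lemma 3: if `W'_j ≤ W_j` for
every `j`, then `S^{W'}_{(0,0)} ⊆ S^{W}_{(0,0)}` and the worst-case window
constellations satisfy `q^[l]_{W,(i,j)} ≤ q^[l]_{W',(i,j)}` for every `l ≥ 0`
and every section `(i,j)`. -/
theorem stmt8 (dl dr L₂ γ₁ γ₂ : ℕ) (T ε δ : ℝ)
    (hdl : 2 ≤ dl) (hdr : 2 ≤ dr) (hL₂ : 2 ≤ L₂)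
    (hγ₁ : 1 ≤ γ₁) (hγ₂ : 2 ≤ γ₂) (hγ₂L : γ₂ ≤ L₂)
    (hT : T ∈ Set.Icc (0 : ℝ) 1) (hε : ε ∈ Set.Icc (0 : ℝ) 1)
    (hδ : δ ∈ Set.Icc (0 : ℝ) 1)
    (W W' : ZMod L₂ → ℕ) (hWW' : ∀ j, W' j ≤ W j) :
    winConfig L₂ W' ((0 : ℤ), (0 : ZMod L₂)) ⊆ winConfig L₂ W ((0 : ℤ), (0 : ZMod L₂)) ∧
    ∀ (l : ℕ) (p : ℤ × ZMod L₂),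
      worstQ L₂ dl dr γ₁ γ₂ T ε δ W l p ≤ worstQ L₂ dl dr γ₁ γ₂ T ε δ W' l p := by
  have hS := winConfig_mono hWW' ((0 : ℤ), (0 : ZMod L₂))
  exact ⟨hS, winIter_anti hγ₁ hγ₂ hT hε (worstInit_mem_Icc hδ) hS
    fun _ hp => worstInit_of_mem_winConfig hp⟩
end
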